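/- The DAGS-augmented initial-state distribution is a probability mixture whose Nash equilibrium set differs from the original for every positive mixing weight in the counterexample game: for every λ ∈ (0,1], there is no pair (p*, q*) ∈ [0,1]² that is simultaneously a Nash equilibrium of the original game u and a Nash equilibrium of the augmented game in which player 1 maximizes (1-λ)·u(p,q) and player 2 minimizes U_λ(p,q) = (1-λ)·u(p,q) + λ·u(1/2, q). -/

import Mathlib

/-- Player 1's expected payoff in the counterexample matrix game
    A = [[-1, 1], [1, -10]]. -/
noncomputable def u (p q : ℝ) : ℝ :=
  -p*q + p*(1-q) + (1-p)*q - 10*(1-p)*(1-q)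

/-- For every λ ∈ (0,1], no pair (p*, q*) ∈ [0,1]² is simultaneously a Nash
    equilibrium of the original counterexample game u and of the
    DAGS-augmented game in which player 1 maximizes (1-λ)·u(p,q) and
    player 2 minimizes U_λ(p,q) = (1-λ)·u(p,q) + λ·u(1/2, q). -/
theorem stmt_16 :
    ∀ l ∈ Set.Ioc (0:ℝ) 1,
      ¬ ∃ p q : ℝ, p ∈ Set.Icc (0:ℝ) 1 ∧ q ∈ Set.Icc (0:ℝ) 1 ∧
        ((∀ p' ∈ Set.Icc (0:ℝ) 1, u p' q ≤ u p q) ∧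
         (∀ q' ∈ Set.Icc (0:ℝ) 1, u p q' ≥ u p q)) ∧
        ((∀ p' ∈ Set.Icc (0:ℝ) 1, (1 - l) * u p' q ≤ (1 - l) * u p q) ∧
         (∀ q' ∈ Set.Icc (0:ℝ) 1,
           (1 - l) * u p q' + l * u (1/2) q' ≥ (1 - l) * u p q + l * u (1/2) q)) := by
  rintro l ⟨hl0, hl1⟩ ⟨p, q, ⟨hp0, hp1⟩, ⟨hq0, hq1⟩, ⟨h1, h2⟩, ⟨_, h4⟩⟩
  have z : (0:ℝ) ∈ Set.Icc (0:ℝ) 1 := by simp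
  have o : (1:ℝ) ∈ Set.Icc (0:ℝ) 1 := by simp
  have a0 := h1 0 z
  have a1 := h1 1 o
  have b0 := h2 0 z
  have b1 := h2 1 o
  have c0 := h4 0 z
  simp only [u] at a0 a1 b0 b1 c0
  have hp : p = 11 / 13 := by
    rcases lt_trichotomy p (11/13) with h | h | h
    · have hq : q = 0 := by nlinarith
      subst hq
      linarith
    · exact h
    · have hq : q = 1 := by nlinarith
      subst hq
      linarith
  subst hp
  have hq : 0 < q := by
    by_contra hn
    have : q = 0 := by linarith
    subst this
    linarith
  nlinarith [mul_pos hl0 hq]
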